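/- arXiv:2510.21327 — 2 statements merged into one kernel-verified Lean document; each statement's English description precedes it below -/
import Mathlib

section
/- Let Δ ≥ 2 be an integer, let y be an integer with 0 ≤ y ≤ (Δ−2)/2, let G be a finite simple graph of maximum degree at most Δ, and let c be an edge 2-coloring of G solving Π(2y). Let R be the set of red edges of c and, for a vertex v, let d_R(v) be the number of edges of R incident to v. Suppose c' assigns to every edge of R one of the colors red or blue in such a way that every vertex v is incident to either ⌊d_R(v)/2⌋ or ⌊d_R(v)/2⌋ + 1 edges of R that c' colors red. Then the edge 2-coloring of G whose red edges are exactly those edges of R colored red by c' (all other edges of G being blue) solves Π(y). -/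
/-- The quantity `x̃_d = (d/Δ)·(y + 1/2)` as a rational number. -/
def xTilde (Δ y d : ℤ) : ℚ := ((d : ℚ) / (Δ : ℚ)) * ((y : ℚ) + 1 / 2)

/-- An integer `x` is `(y,d)`-admissible (for the maximum degree `Δ`):
with `τ_d = d/(2Δ)`, `α_d = ⌊x̃_d⌋`, `β_d = x̃_d - α_d`, we require
`x ∈ {α_d, α_d + 1}`, `x = α_d` whenever `β_d ≤ τ_d`, and `x = α_d + 1`
whenever `β_d ≥ 1 - τ_d`. -/
def Admissible (Δ y d x : ℤ) : Prop :=
  (x = ⌊xTilde Δ y d⌋ ∨ x = ⌊xTilde Δ y d⌋ + 1) ∧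
  (xTilde Δ y d - (⌊xTilde Δ y d⌋ : ℚ) ≤ (d : ℚ) / (2 * (Δ : ℚ)) → x = ⌊xTilde Δ y d⌋) ∧
  (1 - (d : ℚ) / (2 * (Δ : ℚ)) ≤ xTilde Δ y d - (⌊xTilde Δ y d⌋ : ℚ) →
    x = ⌊xTilde Δ y d⌋ + 1)

/-- The number of red edges (`c e = true`) incident to `v`. -/
def dRed {V : Type} [Fintype V] [DecidableEq V] (G : SimpleGraph V)
    [DecidableRel G.Adj] (c : Sym2 V → Bool) (v : V) : ℕ :=
  ((G.incidenceFinset v).filter (fun e => c e = true)).card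

/-- An edge 2-coloring `c` (with `true` = red, `false` = blue) of a graph `G` of
maximum degree at most `Δ` solves `Π(y)` if (i) every vertex of degree `Δ` has
`d_red(v) ∈ {y, y+1}` and (ii) for every `d ∈ {1, …, Δ-1}` there exists a
`(y,d)`-admissible integer `x_d` such that every vertex of degree `d` has
`d_red(v) ∈ {x_d - 1, x_d, x_d + 1}`. -/
def SolvesPi {V : Type} [Fintype V] [DecidableEq V] (Δ y : ℤ)
    (G : SimpleGraph V) [DecidableRel G.Adj] (c : Sym2 V → Bool) : Prop :=
  (∀ v : V, (G.degree v : ℤ) = Δ →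
      ((dRed G c v : ℤ) = y ∨ (dRed G c v : ℤ) = y + 1)) ∧
  (∀ d : ℤ, 1 ≤ d → d ≤ Δ - 1 →
    ∃ x : ℤ, Admissible Δ y d x ∧
      ∀ v : V, (G.degree v : ℤ) = d →
        ((dRed G c v : ℤ) = x - 1 ∨ (dRed G c v : ℤ) = x ∨ (dRed G c v : ℤ) = x + 1))

/-- The defining quantities of `Π(2y)` and `Π(y)` satisfy `x̃_d(2y) = 2 x̃_d(y) - τ_d`. -/
theorem xTilde_two_mul (Δ y d : ℤ) :
    xTilde Δ (2 * y) d = 2 * xTilde Δ y d - (d : ℚ) / (2 * (Δ : ℚ)) := by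
  unfold xTilde
  rw [mul_comm (2 : ℚ) (Δ : ℚ), ← div_div]
  push_cast
  ring

/-- Rounding up half of a `(2y,d)`-admissible integer gives a `(y,d)`-admissible integer. -/
theorem Admissible.half {Δ y d x : ℤ} (hd1 : 1 ≤ d) (hd : d ≤ Δ - 1)
    (h : Admissible Δ (2 * y) d x) : Admissible Δ y d ((x + 1) / 2) := by
  obtain ⟨hx, hlow, hhigh⟩ := h
  have hb := xTilde_two_mul Δ y d
  unfold Admissible
  have hτ0 : 0 < (d : ℚ) / (2 * (Δ : ℚ)) := by
    have h1 : (0 : ℚ) < d := by exact_mod_cast hd1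
    have h2 : (0 : ℚ) < Δ := by exact_mod_cast (by omega : 0 < Δ)
    positivity
  have hτ1 : (d : ℚ) / (2 * (Δ : ℚ)) < 1 / 2 := by
    have h2 : (0 : ℚ) < Δ := by exact_mod_cast (by omega : 0 < Δ)
    have h3 : (d : ℚ) < Δ := by exact_mod_cast (by omega : d < Δ)
    rw [div_lt_div_iff₀ (by positivity) (by norm_num)]
    linarith
  generalize (d : ℚ) / (2 * (Δ : ℚ)) = τ at *
  generalize xTilde Δ (2 * y) d = b at *
  generalize xTilde Δ y d = a at *
  have ha0 := Int.floor_le a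
  have ha1 := Int.lt_floor_add_one a
  have hb0 := Int.floor_le b
  have hb1 := Int.lt_floor_add_one b
  generalize ⌊a⌋ = α at *
  generalize ⌊b⌋ = γ at *
  have hγ0 : 2 * α - 1 ≤ γ := by
    have : 2 * (α : ℚ) - 1 < γ + 1 := by linarith
    have : 2 * α - 1 < γ + 1 := by exact_mod_cast this
    omega
  have hγ1 : γ ≤ 2 * α + 1 := by
    have : (γ : ℚ) < 2 * α + 2 := by linarith
    have : γ < 2 * α + 2 := by exact_mod_cast this
    omega
  obtain rfl | rfl | rfl : γ = 2 * α - 1 ∨ γ = 2 * α ∨ γ = 2 * α + 1 := by omega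
  · push_cast at *
    have hx' := hhigh (by linarith)
    refine ⟨by omega, fun _ => by omega, fun _ => ?_⟩
    linarith
  · push_cast at *
    refine ⟨by omega, fun hβ => ?_, fun hβ => ?_⟩
    · have hx' := hlow (by linarith)
      omega
    · have hx' := hhigh (by linarith)
      omega
  · push_cast at *
    refine ⟨by omega, fun hβ => ?_, fun _ => by omega⟩
    linarith

/-- Let `Δ ≥ 2`, let `y` be an integer with `0 ≤ y ≤ (Δ-2)/2`, let
`G` have maximum degree at most `Δ`, and let `c` be an edge 2-coloring of `G` solving
`Π(2y)`.  Suppose `c'` recolors the red edges of `c` in such a way that every vertex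
`v` is incident to either `⌊d_R(v)/2⌋` or `⌊d_R(v)/2⌋ + 1` edges that are red in `c`
and recolored red by `c'` (where `d_R(v)` is the number of edges red in `c` incident
to `v`).  Then the edge 2-coloring of `G` whose red edges are exactly the edges red in
`c` and recolored red by `c'` solves `Π(y)`. -/
theorem solvesPi_of_split_even {V : Type} [Fintype V] [DecidableEq V]
    (G : SimpleGraph V) [DecidableRel G.Adj]
    (Δ y : ℤ) (hΔ : 2 ≤ Δ) (hy0 : 0 ≤ y) (hy1 : (y : ℚ) ≤ ((Δ : ℚ) - 2) / 2)
    (hmax : ∀ v : V, (G.degree v : ℤ) ≤ Δ)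
    (c : Sym2 V → Bool) (hc : SolvesPi Δ (2 * y) G c)
    (c' : Sym2 V → Bool)
    (hc' : ∀ v : V,
      dRed G (fun e => c e && c' e) v = dRed G c v / 2 ∨
      dRed G (fun e => c e && c' e) v = dRed G c v / 2 + 1) :
    SolvesPi Δ y G (fun e => c e && c' e) := by
  refine ⟨fun v hv => ?_, fun d hd1 hd => ?_⟩
  · have h1 := hc.1 v hv
    have h2 := hc' v
    omega
  · obtain ⟨x, hx, hred⟩ := hc.2 d hd1 hd
    refine ⟨(x + 1) / 2, hx.half hd1 hd, fun v hv => ?_⟩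
    have h1 := hred v hv
    have h2 := hc' v
    omega
end

section
/- Let Δ ≥ 2 be an integer, let y be an integer with 0 ≤ y ≤ (Δ−3)/2, let G be a finite simple graph of maximum degree at most Δ, and let c be an edge 2-coloring of G solving Π(2y+1). Let R be the set of red edges of c and, for a vertex v, let d_R(v) be the number of edges of R incident to v. Suppose c' assigns to every edge of R one of the colors red or blue in such a way that every vertex v is incident to either ⌈d_R(v)/2⌉ − 1 or ⌈d_R(v)/2⌉ edges of R that c' colors red. Then the edge 2-coloring of G whose red edges are exactly those edges of R colored red by c' (all other edges of G being blue) solves Π(y). -/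
/-- Admissibility means that `x` lies at distance less than `1 - d/(2Δ)` from `x̃_d`. -/
theorem admissible_iff {Δ y d x : ℤ} (hd : 1 ≤ d) (hdΔ : d ≤ Δ - 1) :
    Admissible Δ y d x ↔
      xTilde Δ y d - x < 1 - (d : ℚ) / (2 * Δ) ∧ (x : ℚ) - xTilde Δ y d < 1 - (d : ℚ) / (2 * Δ) := by
  have hd' : (1 : ℚ) ≤ d := by exact_mod_cast hd
  have hdΔ' : (d : ℚ) ≤ Δ - 1 := by exact_mod_cast hdΔ
  have hpos : 0 < (d : ℚ) / (2 * Δ) := by apply div_pos <;> linarith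
  have hhalf : (d : ℚ) / (2 * Δ) < 1 / 2 := by
    rw [div_lt_iff₀ (by linarith)]
    linarith
  unfold Admissible
  generalize (d : ℚ) / (2 * Δ) = τ at *
  generalize xTilde Δ y d = X
  have hl := Int.floor_le X
  have hu := Int.lt_floor_add_one X
  generalize ⌊X⌋ = α at *
  constructor
  · rintro ⟨rfl | rfl, h₁, h₂⟩
    · have : ¬ 1 - τ ≤ X - x := fun h => by have := h₂ h; omega
      exact ⟨by linarith, by linarith⟩
    · have : ¬ X - α ≤ τ := fun h => by have := h₁ h; omega
      push_cast
      exact ⟨by linarith, by linarith⟩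
  · rintro ⟨h₁, h₂⟩
    have hlo : α - 1 < x := by
      have : ((α - 1 : ℤ) : ℚ) < x := by push_cast; linarith
      exact_mod_cast this
    have hhi : x < α + 2 := by
      have : (x : ℚ) < ((α + 2 : ℤ) : ℚ) := by push_cast; linarith
      exact_mod_cast this
    obtain rfl | rfl : x = α ∨ x = α + 1 := by omega
    · exact ⟨Or.inl rfl, fun _ => rfl, fun h => by linarith⟩
    · push_cast at h₁ h₂
      exact ⟨Or.inr rfl, fun h => by linarith, fun _ => rfl⟩

/-- Halving an admissible value for `2y + 1` gives an admissible value for `y`. -/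
theorem Admissible.div_two {Δ y d x : ℤ} (hd : 1 ≤ d) (hdΔ : d ≤ Δ - 1)
    (h : Admissible Δ (2 * y + 1) d x) : Admissible Δ y d (x / 2) := by
  rw [admissible_iff hd hdΔ] at h ⊢
  have hd' : (1 : ℚ) ≤ d := by exact_mod_cast hd
  have hdΔ' : (d : ℚ) ≤ Δ - 1 := by exact_mod_cast hdΔ
  have hΔ : (0 : ℚ) < Δ := by linarith
  have hhalf : (d : ℚ) / (2 * Δ) < 1 / 2 := by
    rw [div_lt_iff₀ (by linarith)]
    linarith
  have key : xTilde Δ (2 * y + 1) d = 2 * xTilde Δ y d + (d : ℚ) / (2 * Δ) := by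
    unfold xTilde
    push_cast
    field_simp
  rw [key] at h
  have hlo : (2 : ℚ) * (x / 2 : ℤ) ≤ x := by exact_mod_cast (by omega : 2 * (x / 2) ≤ x)
  have hhi : (x : ℚ) ≤ 2 * (x / 2 : ℤ) + 1 := by
    exact_mod_cast (by omega : x ≤ 2 * (x / 2) + 1)
  obtain ⟨h₁, h₂⟩ := h
  constructor <;> linarith

theorem ceil_natCast_div_two (n : ℕ) : ⌈(n : ℚ) / 2⌉ = ((n : ℤ) + 1) / 2 := by
  rw [Int.ceil_eq_iff]
  have hlo : (2 : ℚ) * (((n : ℤ) + 1) / 2 : ℤ) ≤ n + 1 := by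
    exact_mod_cast (by omega : 2 * (((n : ℤ) + 1) / 2) ≤ n + 1)
  have hhi : (n : ℚ) ≤ 2 * (((n : ℤ) + 1) / 2 : ℤ) := by
    exact_mod_cast (by omega : (n : ℤ) ≤ 2 * (((n : ℤ) + 1) / 2))
  constructor <;> linarith

/-- Let `Δ ≥ 2`, let `y` be an integer with `0 ≤ y ≤ (Δ-3)/2`, let
`G` have maximum degree at most `Δ`, and let `c` be an edge 2-coloring of `G` solving
`Π(2y+1)`.  Suppose `c'` recolors the red edges of `c` in such a way that every vertex
`v` is incident to either `⌈d_R(v)/2⌉ - 1` or `⌈d_R(v)/2⌉` edges that are red in `c`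
and recolored red by `c'` (where `d_R(v)` is the number of edges red in `c` incident
to `v`).  Then the edge 2-coloring of `G` whose red edges are exactly the edges red in
`c` and recolored red by `c'` solves `Π(y)`. -/
theorem solvesPi_of_split_odd {V : Type} [Fintype V] [DecidableEq V]
    (G : SimpleGraph V) [DecidableRel G.Adj]
    (Δ y : ℤ) (hΔ : 2 ≤ Δ) (hy0 : 0 ≤ y) (hy1 : (y : ℚ) ≤ ((Δ : ℚ) - 3) / 2)
    (hmax : ∀ v : V, (G.degree v : ℤ) ≤ Δ)
    (c : Sym2 V → Bool) (hc : SolvesPi Δ (2 * y + 1) G c)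
    (c' : Sym2 V → Bool)
    (hc' : ∀ v : V,
      (dRed G (fun e => c e && c' e) v : ℤ) = ⌈(dRed G c v : ℚ) / 2⌉ - 1 ∨
      (dRed G (fun e => c e && c' e) v : ℤ) = ⌈(dRed G c v : ℚ) / 2⌉) :
    SolvesPi Δ y G (fun e => c e && c' e) := by
  simp only [ceil_natCast_div_two] at hc'
  refine ⟨fun v hv => ?_, fun d hd hdΔ => ?_⟩
  · have h := hc.1 v hv
    have h' := hc' v
    omega
  · obtain ⟨x, hx, hred⟩ := hc.2 d hd hdΔ
    refine ⟨x / 2, hx.div_two hd hdΔ, fun v hv => ?_⟩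
    have h := hred v hv
    have h' := hc' v
    omega
end
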